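/- arXiv:1408.0250 — 3 statements merged into one kernel-verified Lean document; each statement's English description precedes it below -/
import Mathlib

section
/- Let X be a metric space that is strongly hyperbolic with parameter ε > 0, let o ∈ X, and let (x_i) and (y_i) be two sequences in X, each converging to infinity (i.e. (x_i,x_j)_o → ∞ and (y_i,y_j)_o → ∞ as i, j → ∞). Then the sequence (exp(−ε(x_i,y_i)_o))_i converges. -/
/-- The Gromov product of `x` and `y` with respect to the basepoint `o`:
`(x,y)_o = (d(x,o) + d(y,o) - d(x,y)) / 2`. -/
noncomputable def gromovProduct {X : Type*} [MetricSpace X] (o x y : X) : ℝ :=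
  (dist x o + dist y o - dist x y) / 2

/-- A metric space `X` is *strongly hyperbolic* with parameter `ε > 0` if
`exp(-ε (x,y)_o) ≤ exp(-ε (x,z)_o) + exp(-ε (z,y)_o)` for all `x, y, z, o ∈ X`. -/
def StronglyHyperbolicWith (X : Type*) [MetricSpace X] (ε : ℝ) : Prop :=
  ∀ x y z o : X,
    Real.exp (-ε * gromovProduct o x y) ≤
      Real.exp (-ε * gromovProduct o x z) + Real.exp (-ε * gromovProduct o z y)

theorem gromovProduct_comm {X : Type*} [MetricSpace X] (o x y : X) :
    gromovProduct o x y = gromovProduct o y x := by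
  simp only [gromovProduct, dist_comm x y, add_comm (dist x o)]

theorem StronglyHyperbolicWith.dist_exp_gromovProduct_le {X : Type*} [MetricSpace X] {ε : ℝ}
    (h : StronglyHyperbolicWith X ε) (o x y x' y' : X) :
    dist (Real.exp (-ε * gromovProduct o x y)) (Real.exp (-ε * gromovProduct o x' y')) ≤
      Real.exp (-ε * gromovProduct o x x') + Real.exp (-ε * gromovProduct o y y') := by
  have h₁ := h x y x' o
  have h₂ := h x' y y' o
  have h₃ := h x' y' x o
  have h₄ := h x y' y o
  rw [gromovProduct_comm o y' y] at h₂
  rw [gromovProduct_comm o x' x] at h₃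
  rw [Real.dist_eq, abs_sub_le_iff]
  constructor <;> linarith

theorem tendsto_exp_neg_mul_atTop {α : Type*} {l : Filter α} {f : α → ℝ} {ε : ℝ} (hε : 0 < ε)
    (hf : Filter.Tendsto f l Filter.atTop) :
    Filter.Tendsto (fun a => Real.exp (-ε * f a)) l (nhds 0) :=
  Real.tendsto_exp_atBot.comp (hf.const_mul_atTop_of_neg (neg_lt_zero.mpr hε))

/-- if `(x_i)` and `(y_i)` both converge to infinity in a strongly hyperbolic
space, then the sequence `exp(-ε (x_i,y_i)_o)` converges. -/
theorem exp_gromovProduct_pair_converges {X : Type*} [MetricSpace X] {ε : ℝ} (hε : 0 < ε)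
    (h : StronglyHyperbolicWith X ε) (o : X) (x y : ℕ → X)
    (hx : Filter.Tendsto (fun p : ℕ × ℕ => gromovProduct o (x p.1) (x p.2))
      Filter.atTop Filter.atTop)
    (hy : Filter.Tendsto (fun p : ℕ × ℕ => gromovProduct o (y p.1) (y p.2))
      Filter.atTop Filter.atTop) :
    ∃ l : ℝ, Filter.Tendsto (fun i => Real.exp (-ε * gromovProduct o (x i) (y i)))
      Filter.atTop (nhds l) := by
  refine cauchySeq_tendsto_of_complete (cauchySeq_iff_tendsto_dist_atTop_0.mpr ?_)
  refine squeeze_zero (fun _ => dist_nonneg)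
    (fun p => h.dist_exp_gromovProduct_le o (x p.1) (y p.1) (x p.2) (y p.2)) ?_
  simpa using (tendsto_exp_neg_mul_atTop hε hx).add (tendsto_exp_neg_mul_atTop hε hy)
end

section
/- The hyperbolic upper half-plane ℍ² is log 2-hyperbolic: for all points x, y, z, o of ℍ², (x,y)_o ≥ min{(x,z)_o, (y,z)_o} − log 2, where (x,y)_o = (1/2)(d(x,o)+d(y,o)−d(x,y)) is the Gromov product. -/
open scoped UpperHalfPlane

open ComplexConjugate in
/-- Ptolemy's inequality for sums of distances to a point and to its complex conjugate. -/
theorem Complex.ptolemy_dist_add_dist_conj (x y z o : ℂ) :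
    (dist x y + dist x (conj y)) * (dist z o + dist z (conj o)) ≤
      (dist x z + dist x (conj z)) * (dist y o + dist y (conj o)) +
        (dist y z + dist y (conj z)) * (dist x o + dist x (conj o)) := by
  have ptolemy (a b c d : ℂ) : dist a b * dist c d ≤ dist a c * dist b d + dist b c * dist a d := by
    have := EuclideanGeometry.mul_dist_le_mul_dist_add_mul_dist a c b d
    rwa [dist_comm c b] at this
  have h₁ := ptolemy x y z o
  have h₂ := ptolemy x y (conj z) (conj o)
  have h₃ := ptolemy x y z (conj o)
  have h₄ := ptolemy x y (conj z) o
  have h₅ := ptolemy x (conj y) z o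
  have h₆ := ptolemy x (conj y) (conj z) (conj o)
  have h₇ := ptolemy x (conj y) z (conj o)
  have h₈ := ptolemy x (conj y) (conj z) o
  simp only [Complex.dist_conj_comm, Complex.conj_conj] at h₁ h₂ h₃ h₄ h₅ h₆ h₇ h₈
  linarith

/-- Ptolemy's inequality for `exp (dist · · / 2)` on the upper half-plane. -/
theorem UpperHalfPlane.ptolemy_exp_half_dist (x y z o : ℍ) :
    Real.exp (dist x y / 2) * Real.exp (dist z o / 2) ≤
      Real.exp (dist x z / 2) * Real.exp (dist y o / 2) +
        Real.exp (dist y z / 2) * Real.exp (dist x o / 2) := by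
  have hx := Real.sqrt_pos.2 x.im_pos
  have hy := Real.sqrt_pos.2 y.im_pos
  have hz := Real.sqrt_pos.2 z.im_pos
  have ho := Real.sqrt_pos.2 o.im_pos
  simp only [UpperHalfPlane.exp_half_dist, Real.sqrt_mul x.im_pos.le, Real.sqrt_mul y.im_pos.le,
    Real.sqrt_mul z.im_pos.le]
  have h := div_le_div_of_nonneg_right (Complex.ptolemy_dist_add_dist_conj x y z o)
    (by positivity : 0 ≤ 4 * (√x.im * √y.im * √z.im * √o.im))
  refine (Eq.trans_le ?_ h).trans_eq ?_
  · field_simp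
    ring
  · field_simp
    ring

/-- the hyperbolic plane `ℍ²` is `log 2`-hyperbolic. -/
theorem upperHalfPlane_log_two_hyperbolic (x y z o : ℍ) :
    gromovProduct o x y ≥ min (gromovProduct o x z) (gromovProduct o y z) - Real.log 2 := by
  have h := UpperHalfPlane.ptolemy_exp_half_dist x y z o
  simp only [← Real.exp_add] at h
  have key {a b c : ℝ} (h : Real.exp a ≤ Real.exp b + Real.exp c) (hbc : b ≤ c) :
      a ≤ Real.log 2 + c := by
    rw [← Real.exp_le_exp, Real.exp_add, Real.exp_log two_pos]
    linarith [Real.exp_le_exp.2 hbc]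
  simp only [gromovProduct, ge_iff_le, sub_le_iff_le_add, min_le_iff]
  rcases le_total (dist x z / 2 + dist y o / 2) (dist y z / 2 + dist x o / 2) with hle | hle
  · right
    linarith [key h hle]
  · left
    rw [add_comm (Real.exp _) (Real.exp _)] at h
    linarith [key h hle]
end

section
/- Let X be a metric space that is strongly hyperbolic with parameter ε > 0. Then X satisfies condition (EB): there exists R₀ > 0 such that, with L = 4/ε and λ = ε/2, one has |d(x,y)+d(z,t)−d(x,t)−d(z,y)| ≤ L·exp(−λR) whenever x, y, z, t ∈ X satisfy d(x,y)+d(z,t)−d(x,z)−d(y,t) ≥ R ≥ R₀. -/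
/-- The four-point form of strong hyperbolicity. -/
theorem StronglyHyperbolicWith.exp_four_point {X : Type*} [MetricSpace X] {ε : ℝ}
    (h : StronglyHyperbolicWith X ε) (x y z t : X) :
    Real.exp (ε / 2 * (dist x y + dist z t)) ≤
      Real.exp (ε / 2 * (dist x z + dist y t)) + Real.exp (ε / 2 * (dist z y + dist x t)) := by
  have key := mul_le_mul_of_nonneg_right (h x y z t)
    (Real.exp_pos (ε / 2 * (dist x t + dist y t + dist z t))).le
  rw [add_mul, ← Real.exp_add, ← Real.exp_add, ← Real.exp_add] at key
  simp only [gromovProduct] at key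
  ring_nf at key ⊢
  exact key

/-- If `exp a ≤ exp b + exp c` with `exp (b - a) ≤ u ≤ 1 / 2`, then `a` exceeds `c` by at most
`2 * u`. -/
theorem sub_le_two_mul_of_exp_le_add {a b c u : ℝ}
    (h : Real.exp a ≤ Real.exp b + Real.exp c) (hb : Real.exp (b - a) ≤ u) (hu : u ≤ 1 / 2) :
    a - c ≤ 2 * u := by
  have hu0 : 0 < u := (Real.exp_pos _).trans_le hb
  have hsum : 1 ≤ u + Real.exp (c - a) := by
    have h1 : 1 ≤ Real.exp (b - a) + Real.exp (c - a) := by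
      rw [Real.exp_sub, Real.exp_sub, ← add_div, one_le_div (Real.exp_pos a)]
      exact h
    linarith
  have hprod : Real.exp (a - c) * Real.exp (c - a) = 1 := by
    rw [← Real.exp_add]
    simp
  have hexp : Real.exp (a - c) * (1 - u) ≤ 1 := by
    nlinarith [Real.exp_pos (a - c)]
  nlinarith [Real.add_one_le_exp (a - c)]

/-- If `exp c ≤ exp a + exp b` with `exp (b - a) ≤ u`, then `c` exceeds `a` by at most `u`. -/
theorem sub_le_of_exp_le_add {a b c u : ℝ}
    (h : Real.exp c ≤ Real.exp a + Real.exp b) (hb : Real.exp (b - a) ≤ u) :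
    c - a ≤ u := by
  have h1 : Real.exp (c - a) ≤ 1 + Real.exp (b - a) := by
    rw [Real.exp_sub, Real.exp_sub, div_le_iff₀ (Real.exp_pos a), add_mul,
      div_mul_cancel₀ _ (Real.exp_pos a).ne', one_mul]
    exact h
  linarith [Real.add_one_le_exp (c - a)]

/-- a strongly hyperbolic space satisfies condition (EB) with
`L = 4/ε` and `λ = ε/2`. -/
theorem strongly_hyperbolic_implies_eb {X : Type*} [MetricSpace X] {ε : ℝ} (hε : 0 < ε)
    (h : StronglyHyperbolicWith X ε) :
    ∃ R₀ > (0 : ℝ), ∀ x y z t : X, ∀ R : ℝ, R₀ ≤ R →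
      R ≤ dist x y + dist z t - dist x z - dist y t →
      |dist x y + dist z t - dist x t - dist z y| ≤ 4 / ε * Real.exp (-(ε / 2) * R) := by
  refine ⟨2 / ε, by positivity, fun x y z t R hR₀ hR => ?_⟩
  have hu : Real.exp (-(ε / 2) * R) ≤ 1 / 2 := by
    rw [div_le_iff₀ hε] at hR₀
    calc Real.exp (-(ε / 2) * R) ≤ Real.exp (-1) := Real.exp_le_exp.2 (by linarith)
      _ = 1 / Real.exp 1 := by rw [Real.exp_neg, one_div]
      _ ≤ 1 / 2 := by
        have := Real.add_one_le_exp (1 : ℝ)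
        exact one_div_le_one_div_of_le (by norm_num) (by linarith)
  have hb : Real.exp (ε / 2 * (dist x z + dist y t) - ε / 2 * (dist x y + dist z t)) ≤
      Real.exp (-(ε / 2) * R) :=
    Real.exp_le_exp.2 (by nlinarith)
  have upper := sub_le_two_mul_of_exp_le_add (h.exp_four_point x y z t) hb hu
  have four_point : Real.exp (ε / 2 * (dist z y + dist x t)) ≤
      Real.exp (ε / 2 * (dist x y + dist z t)) + Real.exp (ε / 2 * (dist x z + dist y t)) := by
    simpa only [dist_comm, add_comm] using h.exp_four_point x t y z
  have lower := sub_le_of_exp_le_add four_point hb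
  have hu0 := Real.exp_pos (-(ε / 2) * R)
  rw [div_mul_eq_mul_div, le_div_iff₀ hε, ← abs_of_pos hε, ← abs_mul, abs_of_pos hε, abs_le]
  constructor <;> linarith
end
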